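/- Let M be a uniform random element of M_{n,2}. Then M is singular asymptotically almost surely; that is, P(det(M) = 0) → 1 as n → ∞. -/

import Mathlib

open scoped Classical

noncomputable section

/-- The real 0/1 matrix associated to a Boolean matrix. -/
def b2r {n : ℕ} (A : Matrix (Fin n) (Fin n) Bool) : Matrix (Fin n) (Fin n) ℝ :=
  Matrix.of fun i j => if A i j then (1 : ℝ) else 0

/-- `M_{n,d}`: 0/1 matrices all of whose row and column sums equal `d`. -/
def regSet (n d : ℕ) : Finset (Matrix (Fin n) (Fin n) Bool) :=
  Finset.univ.filter fun A =>
    (∀ i, (Finset.univ.filter fun j => A i j = true).card = d) ∧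
    (∀ j, (Finset.univ.filter fun i => A i j = true).card = d)

/-- Probability of the event `p` for a uniform random element of the finite set `s`. -/
def cprob {α : Type*} [Fintype α] (s : Finset α) (p : α → Prop) : ℝ :=
  ((s.filter p).card : ℝ) / (s.card : ℝ)

/-- The number of elements of `M_{n,2}` satisfying `p`. -/
def regCount (n : ℕ) (p : Matrix (Fin n) (Fin n) Bool → Prop) : ℕ :=
  ((regSet n 2).filter p).card

theorem regCount_congr {n : ℕ} {p q : Matrix (Fin n) (Fin n) Bool → Prop}
    (h : ∀ A ∈ regSet n 2, (p A ↔ q A)) : regCount n p = regCount n q := by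
  rw [regCount, regCount, Finset.filter_congr h]

theorem mem_regSet_iff_sum {n d : ℕ} (A : Matrix (Fin n) (Fin n) Bool) :
    A ∈ regSet n d ↔ (∀ i, ∑ j, (A i j).toNat = d) ∧ ∀ j, ∑ i, (A i j).toNat = d := by
  have h : ∀ b : Bool, b.toNat = if b = true then 1 else 0 := by decide
  simp only [regSet, Finset.mem_filter, Finset.mem_univ, true_and, Finset.card_filter, h]

theorem submatrix_mem_regSet {n d : ℕ} {A : Matrix (Fin n) (Fin n) Bool} (hA : A ∈ regSet n d)
    (σ τ : Equiv.Perm (Fin n)) : A.submatrix σ τ ∈ regSet n d := by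
  rw [mem_regSet_iff_sum] at hA ⊢
  refine ⟨fun i => ?_, fun j => ?_⟩
  · rw [← hA.1 (σ i)]
    exact Equiv.sum_comp τ fun j => (A (σ i) j).toNat
  · rw [← hA.2 (τ j)]
    exact Equiv.sum_comp σ fun i => (A i (τ j)).toNat

/-- Double counting of pairs `(A, i)` with `r A i`, when each `A` has `d` partners and the numbers
of partners of the indices all agree. -/
theorem card_mul_regCount {n : ℕ} {ι : Type*} [Fintype ι]
    (p : Matrix (Fin n) (Fin n) Bool → Prop) (r : Matrix (Fin n) (Fin n) Bool → ι → Bool)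
    (i₀ : ι) (d : ℕ) (hd : ∀ A ∈ regSet n 2, p A → ∑ i, (r A i).toNat = d)
    (hi : ∀ i, regCount n (fun A => p A ∧ r A i = true) =
      regCount n (fun A => p A ∧ r A i₀ = true)) :
    Fintype.card ι * regCount n (fun A => p A ∧ r A i₀ = true) = d * regCount n p := by
  have hb : ∀ b : Bool, b.toNat = if b = true then 1 else 0 := by decide
  have h := Finset.card_mul_eq_card_mul (s := (regSet n 2).filter p) (t := Finset.univ)
    (fun A i => r A i = true) (m := d) (n := regCount n (fun A => p A ∧ r A i₀ = true))
    (fun A hA => by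
      rw [Finset.mem_filter] at hA
      rw [← hd A hA.1 hA.2, Finset.bipartiteAbove, Finset.card_filter]
      simp only [hb])
    (fun i _ => by
      rw [← hi i, Finset.bipartiteBelow, regCount, Finset.filter_filter]
      convert rfl)
  rw [Finset.card_univ] at h
  rw [← h, mul_comm, regCount]

theorem regCount_eq_of_perm {n : ℕ} (p q : Matrix (Fin n) (Fin n) Bool → Prop)
    (σ τ : Equiv.Perm (Fin n)) (hσ : ∀ i, σ (σ i) = i) (hτ : ∀ i, τ (τ i) = i)
    (h : ∀ A, p A ↔ q (A.submatrix σ τ)) :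
    regCount n p = regCount n q := by
  have hinv : ∀ A : Matrix (Fin n) (Fin n) Bool, (A.submatrix σ τ).submatrix σ τ = A := by
    intro A; ext i j; simp [hσ, hτ]
  refine Finset.card_nbij' (fun A => A.submatrix σ τ) (fun A => A.submatrix σ τ) ?_ ?_ ?_ ?_
  · intro A hA
    rw [Finset.mem_coe, Finset.mem_filter] at hA ⊢
    exact ⟨submatrix_mem_regSet hA.1 σ τ, (h A).1 hA.2⟩
  · intro A hA
    rw [Finset.mem_coe, Finset.mem_filter] at hA ⊢
    exact ⟨submatrix_mem_regSet hA.1 σ τ, (h _).2 (by rw [hinv]; exact hA.2)⟩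
  · intro A _; exact hinv A
  · intro A _; exact hinv A

theorem card_corner {n : ℕ} (p : Matrix (Fin (n + 1)) (Fin (n + 1)) Bool → Prop)
    (hp : ∀ A (σ τ : Equiv.Perm (Fin (n + 1))), p A → p (A.submatrix σ τ)) :
    (n + 1) * regCount (n + 1) (fun A => p A ∧ A 0 0 = true) = 2 * regCount (n + 1) p := by
  have h := card_mul_regCount p (fun A j => A 0 j) 0 2
    (fun A hA _ => ((mem_regSet_iff_sum A).1 hA).1 0) ?_
  · rwa [Fintype.card_fin] at h
  · intro j
    refine regCount_eq_of_perm _ _ 1 (Equiv.swap 0 j) (by simp) (by simp) fun A => ?_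
    have hA : p A ↔ p (A.submatrix (1 : Equiv.Perm (Fin (n + 1))) (Equiv.swap 0 j)) :=
      ⟨hp A _ _, fun h => by
        have := hp _ 1 (Equiv.swap 0 j) h
        rwa [show (A.submatrix (1 : Equiv.Perm (Fin (n + 1))) (Equiv.swap 0 j)).submatrix
          (1 : Equiv.Perm (Fin (n + 1))) (Equiv.swap 0 j) = A by ext; simp] at this⟩
    rw [← hA]; simp

theorem card_elbow {n : ℕ} (p : Matrix (Fin (n + 2)) (Fin (n + 2)) Bool → Prop)
    (hp : ∀ A (σ τ : Equiv.Perm (Fin (n + 2))), σ 0 = 0 → τ 0 = 0 → p A → p (A.submatrix σ τ)) :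
    (n + 1) ^ 2 * regCount (n + 2) (fun A =>
        ((p A ∧ A 0 0 = true) ∧ A 0 1 = true) ∧ A 1 0 = true) =
      regCount (n + 2) (fun A => p A ∧ A 0 0 = true) := by
  have hpi : ∀ A (σ τ : Equiv.Perm (Fin (n + 2))), σ 0 = 0 → τ 0 = 0 → (∀ i, σ (σ i) = i) →
      (∀ i, τ (τ i) = i) → (p A ↔ p (A.submatrix σ τ)) := by
    intro A σ τ h1 h2 h3 h4
    refine ⟨hp A _ _ h1 h2, fun h => ?_⟩
    have := hp _ σ τ h1 h2 h
    rwa [show (A.submatrix σ τ).submatrix σ τ = A by ext; simp [h3, h4]] at this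
  have hs : ∀ j : Fin (n + 1), Equiv.swap (1 : Fin (n + 2)) j.succ 0 = 0 := fun j =>
    Equiv.swap_apply_of_ne_of_ne (by simp) (Fin.succ_ne_zero j).symm
  have h := card_mul_regCount (fun A => p A ∧ A 0 0 = true)
    (fun A (j : Fin (n + 1)) => A 0 j.succ) 0 1 ?_ ?_
  · have h' := card_mul_regCount (fun A => (p A ∧ A 0 0 = true) ∧ A 0 1 = true)
      (fun A (j : Fin (n + 1)) => A j.succ 0) 0 1 ?_ ?_
    · simp only [Fintype.card_fin, Fin.succ_zero_eq_one, one_mul] at h h'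
      rw [← h, ← h']; ring
    · intro A hA hp
      have h0 := ((mem_regSet_iff_sum A).1 hA).2 0
      rw [Fin.sum_univ_succ, hp.1.2] at h0
      exact Nat.add_left_cancel (n := 1) h0
    · intro j
      refine regCount_eq_of_perm _ _ (Equiv.swap 1 j.succ) 1 (by simp) (by simp) fun A => ?_
      rw [← hpi A _ _ (hs j) (by simp) (by simp) (by simp)]
      simp [hs]
  · intro A hA hp
    have h0 := ((mem_regSet_iff_sum A).1 hA).1 0
    rw [Fin.sum_univ_succ, hp.2] at h0
    exact Nat.add_left_cancel (n := 1) h0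
  · intro j
    refine regCount_eq_of_perm _ _ 1 (Equiv.swap 1 j.succ) (by simp) (by simp) fun A => ?_
    rw [← hpi A _ _ (by simp) (hs j) (by simp) (by simp)]
    simp [hs]

/-- The inverse of contracting the zeroth row: column `0` is split into two columns. -/
def expand {n : ℕ} (B : Matrix (Fin (n + 1)) (Fin (n + 1)) Bool) :
    Matrix (Fin (n + 2)) (Fin (n + 2)) Bool :=
  Fin.cons (Fin.cons true (Fin.cons true fun _ => false)) fun i =>
    Fin.cons (decide (i = 0)) (Fin.cons (!decide (i = 0) && B i 0) fun j => B i j.succ)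

/-- Adjoin a `2 × 2` block of ones. -/
def adjoinBlock {n : ℕ} (B : Matrix (Fin n) (Fin n) Bool) :
    Matrix (Fin (n + 2)) (Fin (n + 2)) Bool :=
  Fin.cons (Fin.cons true (Fin.cons true fun _ => false)) <|
    Fin.cons (Fin.cons true (Fin.cons true fun _ => false)) fun i =>
      Fin.cons false (Fin.cons false (B i))

theorem toNat_sum_eq_zero {ι : Type*} [Fintype ι] {f : ι → Bool} (h : ∑ i, (f i).toNat = 0)
    (i : ι) : f i = false := by
  have := (Finset.sum_eq_zero_iff.1 h) i (Finset.mem_univ i)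
  cases hf : f i <;> simp_all

@[simp] theorem expand_zero_zero {n : ℕ} (B : Matrix (Fin (n + 1)) (Fin (n + 1)) Bool) :
    expand B 0 0 = true := rfl

@[simp] theorem expand_zero_one {n : ℕ} (B : Matrix (Fin (n + 1)) (Fin (n + 1)) Bool) :
    expand B 0 1 = true := rfl

@[simp] theorem expand_zero_tail {n : ℕ} (B : Matrix (Fin (n + 1)) (Fin (n + 1)) Bool) (j : Fin n) :
    expand B 0 j.succ.succ = false := rfl

@[simp] theorem expand_one_zero {n : ℕ} (B : Matrix (Fin (n + 1)) (Fin (n + 1)) Bool) :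
    expand B 1 0 = true := rfl

@[simp] theorem expand_one_one {n : ℕ} (B : Matrix (Fin (n + 1)) (Fin (n + 1)) Bool) :
    expand B 1 1 = false := rfl

@[simp] theorem expand_one_tail {n : ℕ} (B : Matrix (Fin (n + 1)) (Fin (n + 1)) Bool) (j : Fin n) :
    expand B 1 j.succ.succ = B 0 j.succ := rfl

@[simp] theorem expand_tail_zero {n : ℕ} (B : Matrix (Fin (n + 1)) (Fin (n + 1)) Bool) (i : Fin n) :
    expand B i.succ.succ 0 = false := rfl

@[simp] theorem expand_tail_one {n : ℕ} (B : Matrix (Fin (n + 1)) (Fin (n + 1)) Bool) (i : Fin n) :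
    expand B i.succ.succ 1 = B i.succ 0 := rfl

@[simp] theorem expand_tail_tail {n : ℕ} (B : Matrix (Fin (n + 1)) (Fin (n + 1)) Bool) (i : Fin n) (j : Fin n) :
    expand B i.succ.succ j.succ.succ = B i.succ j.succ := rfl

@[simp] theorem adjoinBlock_zero_zero {n : ℕ} (B : Matrix (Fin n) (Fin n) Bool) :
    adjoinBlock B 0 0 = true := rfl

@[simp] theorem adjoinBlock_zero_one {n : ℕ} (B : Matrix (Fin n) (Fin n) Bool) :
    adjoinBlock B 0 1 = true := rfl

@[simp] theorem adjoinBlock_zero_tail {n : ℕ} (B : Matrix (Fin n) (Fin n) Bool) (j : Fin n) :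
    adjoinBlock B 0 j.succ.succ = false := rfl

@[simp] theorem adjoinBlock_one_zero {n : ℕ} (B : Matrix (Fin n) (Fin n) Bool) :
    adjoinBlock B 1 0 = true := rfl

@[simp] theorem adjoinBlock_one_one {n : ℕ} (B : Matrix (Fin n) (Fin n) Bool) :
    adjoinBlock B 1 1 = true := rfl

@[simp] theorem adjoinBlock_one_tail {n : ℕ} (B : Matrix (Fin n) (Fin n) Bool) (j : Fin n) :
    adjoinBlock B 1 j.succ.succ = false := rfl

@[simp] theorem adjoinBlock_tail_zero {n : ℕ} (B : Matrix (Fin n) (Fin n) Bool) (i : Fin n) :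
    adjoinBlock B i.succ.succ 0 = false := rfl

@[simp] theorem adjoinBlock_tail_one {n : ℕ} (B : Matrix (Fin n) (Fin n) Bool) (i : Fin n) :
    adjoinBlock B i.succ.succ 1 = false := rfl

@[simp] theorem adjoinBlock_tail_tail {n : ℕ} (B : Matrix (Fin n) (Fin n) Bool) (i : Fin n) (j : Fin n) :
    adjoinBlock B i.succ.succ j.succ.succ = B i j := rfl

theorem expand_mem {n : ℕ} {B : Matrix (Fin (n + 1)) (Fin (n + 1)) Bool}
    (hB : B ∈ regSet (n + 1) 2) (h0 : B 0 0 = true) : expand B ∈ regSet (n + 2) 2 := by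
  rw [mem_regSet_iff_sum] at hB ⊢
  obtain ⟨hr, hc⟩ := hB
  simp only [Fin.sum_univ_succ] at hr hc ⊢
  refine ⟨fun i => ?_, fun j => ?_⟩
  · refine Fin.cases ?_ (fun i => ?_) i
    · simp
    · refine Fin.cases ?_ (fun i => ?_) i
      · have := hr 0
        simp_all
      · have := hr i.succ
        simp_all
  · refine Fin.cases ?_ (fun j => ?_) j
    · simp
    · refine Fin.cases ?_ (fun j => ?_) j
      · have := hc 0
        simp_all
      · have := hc j.succ
        simp_all

theorem adjoinBlock_mem_iff {n : ℕ} {B : Matrix (Fin n) (Fin n) Bool} :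
    adjoinBlock B ∈ regSet (n + 2) 2 ↔ B ∈ regSet n 2 := by
  simp only [mem_regSet_iff_sum, Fin.forall_fin_succ]
  simp [Fin.sum_univ_succ]

theorem row_tail_eq_false {n : ℕ} {A : Matrix (Fin (n + 2)) (Fin (n + 2)) Bool}
    (hA : A ∈ regSet (n + 2) 2) {i : Fin (n + 2)} (h0 : A i 0 = true) (h1 : A i 1 = true)
    (j : Fin n) : A i j.succ.succ = false := by
  have h := ((mem_regSet_iff_sum A).1 hA).1 i
  rw [Fin.sum_univ_succ, Fin.sum_univ_succ, h0, Fin.succ_zero_eq_one, h1] at h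
  exact toNat_sum_eq_zero (f := fun j : Fin n => A i j.succ.succ)
    (by simp only [Bool.toNat_true] at h; omega) j

theorem col_tail_eq_false {n : ℕ} {A : Matrix (Fin (n + 2)) (Fin (n + 2)) Bool}
    (hA : A ∈ regSet (n + 2) 2) {j : Fin (n + 2)} (h0 : A 0 j = true) (h1 : A 1 j = true)
    (i : Fin n) : A i.succ.succ j = false := by
  have h := ((mem_regSet_iff_sum A).1 hA).2 j
  rw [Fin.sum_univ_succ, Fin.sum_univ_succ, h0, Fin.succ_zero_eq_one, h1] at h
  exact toNat_sum_eq_zero (f := fun i : Fin n => A i.succ.succ j)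
    (by simp only [Bool.toNat_true] at h; omega) i

theorem exists_adjoinBlock_eq {n : ℕ} {A : Matrix (Fin (n + 2)) (Fin (n + 2)) Bool}
    (hA : A ∈ regSet (n + 2) 2) (h00 : A 0 0 = true) (h01 : A 0 1 = true) (h10 : A 1 0 = true)
    (h11 : A 1 1 = true) : ∃ B ∈ regSet n 2, adjoinBlock B = A := by
  have h : adjoinBlock (A.submatrix (fun i => i.succ.succ) fun j => j.succ.succ) = A := by
    ext i j
    refine Fin.cases ?_ (Fin.cases ?_ fun i => ?_) i <;>
      refine Fin.cases ?_ (Fin.cases ?_ fun j => ?_) j <;>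
      simp [h00, h01, h10, h11,
        row_tail_eq_false hA h00 h01, row_tail_eq_false hA h10 h11, col_tail_eq_false hA h00 h10,
        col_tail_eq_false hA h01 h11]
  exact ⟨_, adjoinBlock_mem_iff.1 (h ▸ hA), h⟩

theorem exists_expand_eq {n : ℕ} {A : Matrix (Fin (n + 2)) (Fin (n + 2)) Bool}
    (hA : A ∈ regSet (n + 2) 2) (h00 : A 0 0 = true) (h01 : A 0 1 = true) (h10 : A 1 0 = true)
    (h11 : A 1 1 = false) :
    ∃ B ∈ regSet (n + 1) 2, B 0 0 = true ∧ expand B = A := by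
  obtain ⟨B, hB0, hBs⟩ : ∃ B : Matrix (Fin (n + 1)) (Fin (n + 1)) Bool,
      (∀ i, B i 0 = (A i.succ 0 || A i.succ 1)) ∧ ∀ i j, B i (Fin.succ j) = A i.succ j.succ.succ :=
    ⟨fun i => Fin.cons (A i.succ 0 || A i.succ 1) fun j => A i.succ j.succ.succ,
      fun _ => rfl, fun _ _ => rfl⟩
  have hrow := row_tail_eq_false hA h00 h01
  have hcol := col_tail_eq_false hA h00 h10
  have h : expand B = A := by
    ext i j
    refine Fin.cases ?_ (Fin.cases ?_ fun i => ?_) i <;>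
      refine Fin.cases ?_ (Fin.cases ?_ fun j => ?_) j <;>
      simp [hB0, hBs, h00, h01, h10, h11, hrow, hcol]
  refine ⟨B, ?_, by simp [hB0, h10], h⟩
  rw [mem_regSet_iff_sum] at hA ⊢
  obtain ⟨hr, hc⟩ := hA
  refine ⟨fun i => ?_, fun j => ?_⟩
  · simp only [Fin.sum_univ_succ]
    refine Fin.cases ?_ (fun i => ?_) i
    · have := hr 1
      simp only [Fin.sum_univ_succ] at this
      simp_all
    · have := hr i.succ.succ
      simp only [Fin.sum_univ_succ] at this
      simp_all
  · refine Fin.cases ?_ (fun j => ?_) j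
    · have := hc 1
      simp only [Fin.sum_univ_succ] at this ⊢
      simp_all
    · have := hc j.succ.succ
      simp only [Fin.sum_univ_succ] at this ⊢
      simp_all

theorem expand_injOn {n : ℕ} :
    Set.InjOn (expand (n := n)) {B | B 0 0 = true} := by
  intro B hB C hC h
  have h' : ∀ i j, expand B i j = expand C i j := fun i j => by rw [h]
  ext i j
  refine Fin.cases ?_ (fun j => ?_) j
  · refine Fin.cases ?_ (fun i => ?_) i
    · simp_all
    · simpa using h' i.succ.succ 1
  · refine Fin.cases ?_ (fun i => ?_) i
    · simpa using h' 1 j.succ.succ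
    · simpa using h' i.succ.succ j.succ.succ

theorem adjoinBlock_injective {n : ℕ} : Function.Injective (adjoinBlock (n := n)) := by
  intro B C h
  ext i j
  have h' : adjoinBlock B i.succ.succ j.succ.succ = adjoinBlock C i.succ.succ j.succ.succ := by
    rw [h]
  simpa using h'

theorem card_split {n : ℕ} (p : Matrix (Fin (n + 2)) (Fin (n + 2)) Bool → Prop) :
    regCount (n + 2) (fun A => ((p A ∧ A 0 0 = true) ∧ A 0 1 = true) ∧ A 1 0 = true) =
      regCount (n + 1) (fun B => p (expand B) ∧ B 0 0 = true) +
        regCount n (fun B => p (adjoinBlock B)) := by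
  unfold regCount
  rw [← Finset.card_filter_add_card_filter_not (fun A => A 1 1 = false)]
  congr 1
  · symm
    refine Finset.card_nbij expand ?_ ?_ ?_
    · intro B hB
      simp only [Finset.mem_coe, Finset.mem_filter] at hB ⊢
      exact ⟨⟨expand_mem hB.1 hB.2.2, ⟨⟨hB.2.1, rfl⟩, rfl⟩, rfl⟩, rfl⟩
    · exact expand_injOn.mono fun B hB => by
        simp only [Finset.mem_coe, Finset.mem_filter] at hB
        exact hB.2.2
    · intro A hA
      simp only [Finset.mem_coe, Finset.mem_filter] at hA
      obtain ⟨⟨hA, ⟨⟨hp, h00⟩, h01⟩, h10⟩, h11⟩ := hA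
      obtain ⟨B, hB, hB0, rfl⟩ := exists_expand_eq hA h00 h01 h10 h11
      exact ⟨B, by simp only [Finset.mem_coe, Finset.mem_filter]; exact ⟨hB, hp, hB0⟩, rfl⟩
  · symm
    refine Finset.card_nbij adjoinBlock ?_ adjoinBlock_injective.injOn ?_
    · intro B hB
      simp only [Finset.mem_coe, Finset.mem_filter] at hB ⊢
      exact ⟨⟨adjoinBlock_mem_iff.2 hB.1, ⟨⟨hB.2, rfl⟩, rfl⟩, rfl⟩, by simp⟩
    · intro A hA
      simp only [Finset.mem_coe, Finset.mem_filter] at hA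
      obtain ⟨⟨hA, ⟨⟨hp, h00⟩, h01⟩, h10⟩, h11⟩ := hA
      obtain ⟨B, hB, rfl⟩ := exists_adjoinBlock_eq hA h00 h01 h10 (by simpa using h11)
      exact ⟨B, by simp only [Finset.mem_coe, Finset.mem_filter]; exact ⟨hB, hp⟩, rfl⟩

/-- Negate the corner entry of a matrix. -/
def negCorner {n : ℕ} (A : Matrix (Fin (n + 1)) (Fin (n + 1)) ℝ) :
    Matrix (Fin (n + 1)) (Fin (n + 1)) ℝ :=
  Matrix.of fun i j => if i = 0 ∧ j = 0 then -A i j else A i j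

theorem b2r_apply {n : ℕ} (A : Matrix (Fin n) (Fin n) Bool) (i j : Fin n) :
    b2r A i j = ((A i j).toNat : ℝ) := by
  cases h : A i j <;> simp [b2r, h]

theorem det_submatrix_ne_zero {n : ℕ} {A : Matrix (Fin n) (Fin n) ℝ} (h : A.det ≠ 0)
    (σ τ : Equiv.Perm (Fin n)) : (A.submatrix σ τ).det ≠ 0 := by
  rwa [← abs_ne_zero, Matrix.abs_det_submatrix_equiv_equiv, abs_ne_zero]

theorem det_b2r_submatrix {n : ℕ} (A : Matrix (Fin n) (Fin n) Bool) (σ τ : Equiv.Perm (Fin n))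
    (h : (b2r A).det ≠ 0) : (b2r (A.submatrix σ τ)).det ≠ 0 :=
  det_submatrix_ne_zero h σ τ

theorem det_negCorner_submatrix {n : ℕ} (A : Matrix (Fin (n + 1)) (Fin (n + 1)) Bool)
    (σ τ : Equiv.Perm (Fin (n + 1))) (hσ : σ 0 = 0) (hτ : τ 0 = 0)
    (h : (negCorner (b2r A)).det ≠ 0) : (negCorner (b2r (A.submatrix σ τ))).det ≠ 0 := by
  convert det_submatrix_ne_zero h σ τ using 2
  ext i j
  have h1 : σ i = 0 ↔ i = 0 := by rw [← hσ, σ.apply_eq_iff_eq, hσ]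
  have h2 : τ j = 0 ↔ j = 0 := by rw [← hτ, τ.apply_eq_iff_eq, hτ]
  simp only [negCorner, b2r_apply, Matrix.of_apply, Matrix.submatrix_apply, h1, h2]

theorem det_contract {n : ℕ} (A : Matrix (Fin (n + 2)) (Fin (n + 2)) ℝ)
    (h : ∀ j : Fin n, A 0 j.succ.succ = 0) :
    A.det = (Matrix.of fun i : Fin (n + 1) =>
      (Fin.cons (A 0 0 * A i.succ 1 - A 0 1 * A i.succ 0) fun j => A i.succ j.succ.succ :
        Fin (n + 1) → ℝ)).det := by
  have hR : (Matrix.of fun i : Fin (n + 1) =>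
      (Fin.cons (A 0 0 * A i.succ 1 - A 0 1 * A i.succ 0) fun j => A i.succ j.succ.succ :
        Fin (n + 1) → ℝ)) = (A.submatrix Fin.succ Fin.succ).updateCol 0
          (A 0 0 • (fun i => A i.succ 1) + (-A 0 1) • fun i => A i.succ 0) := by
    ext i j
    refine Fin.cases ?_ (fun j => ?_) j
    · simp [sub_eq_add_neg]
    · simp
  have h0 : (A.submatrix Fin.succ Fin.succ).updateCol 0 (fun i => A i.succ 1) =
      A.submatrix Fin.succ (Fin.succAbove 0) := by
    ext i j
    refine Fin.cases ?_ (fun j => ?_) j <;> simp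
  have h1 : (A.submatrix Fin.succ Fin.succ).updateCol 0 (fun i => A i.succ 0) =
      A.submatrix Fin.succ (Fin.succAbove 1) := by
    ext i j
    refine Fin.cases ?_ (fun j => ?_) j
    · simp
    · have : Fin.succAbove 1 j.succ = j.succ.succ := by
        rw [← Fin.succ_zero_eq_one, Fin.succ_succAbove_succ, Fin.zero_succAbove]
      simp [this]
  rw [hR, Matrix.det_updateCol_add, Matrix.det_updateCol_smul, Matrix.det_updateCol_smul, h0, h1,
    Matrix.det_succ_row_zero, Fin.sum_univ_succ, Fin.sum_univ_succ]
  simp [h]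

theorem det_expand {n : ℕ} (B : Matrix (Fin (n + 1)) (Fin (n + 1)) Bool) (h0 : B 0 0 = true) :
    (b2r (expand B)).det = (negCorner (b2r B)).det := by
  rw [det_contract _ (by simp [b2r_apply])]
  congr 1
  ext i j
  refine Fin.cases ?_ (fun i => ?_) i <;> refine Fin.cases ?_ (fun j => ?_) j <;>
    simp [negCorner, b2r_apply, h0]

theorem det_negCorner_expand {n : ℕ} (B : Matrix (Fin (n + 1)) (Fin (n + 1)) Bool)
    (h0 : B 0 0 = true) : (negCorner (b2r (expand B))).det = -(b2r B).det := by
  rw [det_contract _ (by simp [negCorner, b2r_apply])]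
  have h := Matrix.det_mul_row (Fin.cons (-1) fun _ => 1 : Fin (n + 1) → ℝ) (b2r B)
  simp only [Fin.prod_univ_succ, Fin.cons_zero, Fin.cons_succ, Finset.prod_const_one, mul_one,
    neg_one_mul] at h
  rw [← h]
  congr 1
  ext i j
  refine Fin.cases ?_ (fun i => ?_) i <;> refine Fin.cases ?_ (fun j => ?_) j <;>
    simp [negCorner, b2r_apply, h0]

theorem det_adjoinBlock {n : ℕ} (B : Matrix (Fin n) (Fin n) Bool) :
    (b2r (adjoinBlock B)).det = 0 :=
  Matrix.det_zero_of_row_eq (i := 0) (j := 1) (by simp) rfl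

theorem det_negCorner_adjoinBlock {n : ℕ} (B : Matrix (Fin n) (Fin n) Bool) :
    (negCorner (b2r (adjoinBlock B))).det = -2 * (b2r B).det := by
  rw [det_contract _ (by simp [negCorner, b2r_apply]), Matrix.det_succ_row_zero, Fin.sum_univ_succ]
  have h : (Matrix.of fun i : Fin (n + 1) =>
      (Fin.cons (negCorner (b2r (adjoinBlock B)) 0 0 * negCorner (b2r (adjoinBlock B)) i.succ 1 -
        negCorner (b2r (adjoinBlock B)) 0 1 * negCorner (b2r (adjoinBlock B)) i.succ 0)
        fun j => negCorner (b2r (adjoinBlock B)) i.succ j.succ.succ :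
        Fin (n + 1) → ℝ)).submatrix Fin.succ (Fin.succAbove 0) = b2r B := by
    ext i j
    simp [negCorner, b2r_apply]
  rw [h]
  simp [negCorner, b2r_apply]
  ring

theorem cornerCount_recursion (n : ℕ) :
    regCount (n + 2) (fun A => True ∧ A 0 0 = true) =
      (n + 1) ^ 2 * (regCount (n + 1) (fun A => True ∧ A 0 0 = true) +
        regCount n fun _ => True) := by
  rw [← card_elbow (fun _ => True) (fun _ _ _ _ _ _ => trivial), card_split (fun _ => True)]

theorem cornerCount_nonsingular_recursion (n : ℕ) :
    regCount (n + 2) (fun A => (b2r A).det ≠ 0 ∧ A 0 0 = true) =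
      (n + 1) ^ 2 * regCount (n + 1) (fun A => (negCorner (b2r A)).det ≠ 0 ∧ A 0 0 = true) := by
  rw [← card_elbow (fun A => (b2r A).det ≠ 0) (fun A σ τ _ _ => det_b2r_submatrix A σ τ),
    card_split (fun A => (b2r A).det ≠ 0)]
  congr 1
  have h : regCount n (fun B => (b2r (adjoinBlock B)).det ≠ 0) = 0 := by
    simp [regCount, det_adjoinBlock]
  rw [h, add_zero]
  refine regCount_congr fun B _ => and_congr_left fun h0 => ?_
  rw [det_expand B h0]

theorem cornerCount_negCorner_recursion (n : ℕ) :
    regCount (n + 2) (fun A => (negCorner (b2r A)).det ≠ 0 ∧ A 0 0 = true) =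
      (n + 1) ^ 2 * (regCount (n + 1) (fun A => (b2r A).det ≠ 0 ∧ A 0 0 = true) +
        regCount n fun A => (b2r A).det ≠ 0) := by
  rw [← card_elbow (fun A => (negCorner (b2r A)).det ≠ 0)
      (fun A σ τ => det_negCorner_submatrix A σ τ),
    card_split (fun A => (negCorner (b2r A)).det ≠ 0)]
  congr 2
  · refine regCount_congr fun B _ => and_congr_left fun h0 => ?_
    rw [det_negCorner_expand B h0, neg_ne_zero]
  · refine regCount_congr fun B _ => ?_
    rw [det_negCorner_adjoinBlock]
    simp

theorem le_mul_rpow_of_recursion {x : ℕ → ℝ} (hx : ∀ k, 0 ≤ x k)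
    (h : ∀ k, x (k + 3) = x (k + 1) + x k / (2 * (k + 1))) :
    ∃ K : ℝ, 0 ≤ K ∧ ∀ k : ℕ, 8 ≤ k → x k ≤ K * ((k : ℝ) + 1) ^ (1 / 3 : ℝ) := by
  have hK : 0 ≤ x 8 + x 9 + x 10 := add_nonneg (add_nonneg (hx 8) (hx 9)) (hx 10)
  refine ⟨x 8 + x 9 + x 10, hK, fun k => ?_⟩
  have hbase : ∀ k : ℕ, x 8 + x 9 + x 10 ≤ (x 8 + x 9 + x 10) * ((k : ℝ) + 1) ^ (1 / 3 : ℝ) :=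
    fun k => le_mul_of_one_le_right hK
      (Real.one_le_rpow (by linarith [k.cast_nonneg (α := ℝ)]) (by norm_num))
  induction k using Nat.strong_induction_on with
  | _ k ih =>
    intro hk
    rcases Nat.lt_or_ge k 11 with hk' | hk'
    · refine le_trans ?_ (hbase k)
      have h8 := hx 8
      have h9 := hx 9
      have h10 := hx 10
      interval_cases k <;> linarith
    · obtain ⟨m, rfl⟩ : ∃ m, k = m + 3 := ⟨k - 3, by omega⟩
      have hm : (8 : ℝ) ≤ m := by exact_mod_cast (by omega : 8 ≤ m)
      have h1 := ih (m + 1) (by omega) (by omega)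
      have h0 := ih m (by omega) (by omega)
      rw [h]
      push_cast at h1 ⊢
      set K := x 8 + x 9 + x 10
      set g3 : ℝ := ((m : ℝ) + 3 + 1) ^ (1 / 3 : ℝ) with hg3
      have hg3p : 0 < g3 := by positivity
      have hB : ((m : ℝ) + 1 + 1) ^ (1 / 3 : ℝ) ≤ g3 * (1 - 2 / (3 * (m + 4))) := by
        have hs : -1 ≤ -(2 / ((m : ℝ) + 4)) := by
          rw [neg_le_neg_iff, div_le_one (by linarith)]; linarith
        have := rpow_one_add_le_one_add_mul_self hs (p := 1 / 3) (by norm_num) (by norm_num)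
        have he : (m : ℝ) + 1 + 1 = (m + 3 + 1) * (1 + -(2 / ((m : ℝ) + 4))) := by
          field_simp; ring
        rw [he, Real.mul_rpow (by linarith) (by linarith)]
        refine (mul_le_mul_of_nonneg_left this hg3p.le).trans_eq ?_
        field_simp
        ring
      have hg0 : ((m : ℝ) + 1) ^ (1 / 3 : ℝ) ≤ g3 :=
        Real.rpow_le_rpow (by linarith) (by linarith) (by norm_num)
      have hdiv : x m / (2 * (m + 1)) ≤ K * g3 / (2 * (m + 1)) :=
        div_le_div_of_nonneg_right (h0.trans (mul_le_mul_of_nonneg_left hg0 hK)) (by linarith)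
      have hc : 1 / (2 * ((m : ℝ) + 1)) ≤ 2 / (3 * (m + 4)) := by
        rw [div_le_div_iff₀ (by linarith) (by linarith)]; linarith
      calc x (m + 1) + x m / (2 * (m + 1))
          ≤ K * (g3 * (1 - 2 / (3 * (m + 4)))) + K * g3 / (2 * (m + 1)) :=
            add_le_add (h1.trans (mul_le_mul_of_nonneg_left hB hK)) hdiv
        _ = K * g3 * (1 - 2 / (3 * (m + 4)) + 1 / (2 * ((m : ℝ) + 1))) := by ring
        _ ≤ K * g3 * 1 := mul_le_mul_of_nonneg_left (by linarith) (by positivity)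
        _ = K * g3 := mul_one _

theorem mul_rpow_le_of_recursion {y : ℕ → ℝ} (hy0 : 0 ≤ y 0) (hy1 : 0 < y 1)
    (h : ∀ k, y (k + 2) = y (k + 1) + y k / (2 * (k + 1))) :
    ∃ c : ℝ, 0 < c ∧ ∀ k : ℕ, 1 ≤ k → c * ((k : ℝ) + 1) ^ (2 / 5 : ℝ) ≤ y k := by
  have hy2 : y 1 ≤ y 2 := by
    have := h 0
    norm_num at this
    linarith
  refine ⟨y 1 / 3, by positivity, fun k => ?_⟩
  have hpow : ∀ a : ℝ, 1 ≤ a → a ^ (2 / 5 : ℝ) ≤ a := fun a ha => by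
    simpa using Real.rpow_le_rpow_of_exponent_le ha (by norm_num : (2 / 5 : ℝ) ≤ 1)
  induction k using Nat.strong_induction_on with
  | _ k ih =>
    intro hk
    rcases Nat.lt_or_ge k 3 with hk' | hk'
    · have hp := mul_le_mul_of_nonneg_left
        (hpow ((k : ℝ) + 1) (by linarith [k.cast_nonneg (α := ℝ)])) (by positivity : 0 ≤ y 1 / 3)
      refine hp.trans ?_
      interval_cases k <;> norm_num <;> linarith
    · obtain ⟨m, rfl⟩ : ∃ m, k = m + 2 := ⟨k - 2, by omega⟩
      have hm : (1 : ℝ) ≤ m := by exact_mod_cast (by omega : 1 ≤ m)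
      have h1 := ih (m + 1) (by omega) (by omega)
      have h0 := ih m (by omega) (by omega)
      rw [h]
      push_cast at h1 ⊢
      set c := y 1 / 3 with hc
      have hcp : 0 < c := by positivity
      have hg : ((m : ℝ) + 2 + 1) ^ (2 / 5 : ℝ) ≤
          ((m : ℝ) + 1 + 1) ^ (2 / 5 : ℝ) + ((m : ℝ) + 1) ^ (2 / 5 : ℝ) / (2 * (m + 1)) := by
        have hs : -1 ≤ 1 / ((m : ℝ) + 2) := le_trans (by norm_num) (by positivity : (0:ℝ) ≤ _)
        have hb := rpow_one_add_le_one_add_mul_self hs (p := 2 / 5) (by norm_num)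
          (by norm_num)
        have he : (m : ℝ) + 2 + 1 = (m + 1 + 1) * (1 + 1 / ((m : ℝ) + 2)) := by
          field_simp; ring
        rw [he, Real.mul_rpow (by linarith) (by positivity)]
        refine (mul_le_mul_of_nonneg_left hb (by positivity)).trans ?_
        have hanti : ((m : ℝ) + 1 + 1) ^ (2 / 5 - 1 : ℝ) ≤ ((m : ℝ) + 1) ^ (2 / 5 - 1 : ℝ) :=
          Real.rpow_le_rpow_of_nonpos (by linarith) (by linarith) (by norm_num)
        rw [Real.rpow_sub_one (by linarith), Real.rpow_sub_one (by linarith)] at hanti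
        have hp : 0 ≤ ((m : ℝ) + 1 + 1) ^ (2 / 5 : ℝ) / (m + 1 + 1) := by positivity
        have e1 : ((m : ℝ) + 1) ^ (2 / 5 : ℝ) / (2 * (m + 1)) =
            1 / 2 * (((m : ℝ) + 1) ^ (2 / 5 : ℝ) / (m + 1)) := by field_simp
        have e2 : ((m : ℝ) + 1 + 1) ^ (2 / 5 : ℝ) * (1 + 2 / 5 * (1 / (m + 2))) =
            ((m : ℝ) + 1 + 1) ^ (2 / 5 : ℝ) +
              2 / 5 * (((m : ℝ) + 1 + 1) ^ (2 / 5 : ℝ) / (m + 1 + 1)) := by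
          rw [show (m : ℝ) + 1 + 1 = m + 2 by ring]; ring
        rw [e1, e2]
        linarith
      calc c * ((m : ℝ) + 2 + 1) ^ (2 / 5 : ℝ)
          ≤ c * (((m : ℝ) + 1 + 1) ^ (2 / 5 : ℝ) + ((m : ℝ) + 1) ^ (2 / 5 : ℝ) / (2 * (m + 1))) :=
            mul_le_mul_of_nonneg_left hg hcp.le
        _ = c * ((m : ℝ) + 1 + 1) ^ (2 / 5 : ℝ) +
            c * ((m : ℝ) + 1) ^ (2 / 5 : ℝ) / (2 * (m + 1)) := by ring
        _ ≤ y (m + 1) + y m / (2 * (m + 1)) :=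
            add_le_add h1 (div_le_div_of_nonneg_right h0 (by positivity))

theorem eventually_le_mul_of_recursions {x y : ℕ → ℝ} (hx0 : ∀ k, 0 ≤ x k) (hy0 : 0 ≤ y 0)
    (hy1 : 0 < y 1) (hx : ∀ k, x (k + 3) = x (k + 1) + x k / (2 * (k + 1)))
    (hy : ∀ k, y (k + 2) = y (k + 1) + y k / (2 * (k + 1))) {ε : ℝ} (hε : 0 < ε) :
    ∀ᶠ k in Filter.atTop, 0 < y k ∧ x k ≤ ε * y k := by
  obtain ⟨K, hK, hxK⟩ := le_mul_rpow_of_recursion hx0 hx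
  obtain ⟨c, hc, hyc⟩ := mul_rpow_le_of_recursion hy0 hy1 hy
  have hlim : Filter.Tendsto (fun k : ℕ => ((k : ℝ) + 1) ^ (1 / 15 : ℝ)) Filter.atTop
      Filter.atTop :=
    (tendsto_rpow_atTop (by norm_num)).comp
      (Filter.tendsto_atTop_add_const_right _ _ tendsto_natCast_atTop_atTop)
  filter_upwards [hlim.eventually_ge_atTop (K / (ε * c)), Filter.eventually_ge_atTop 8]
    with k hk hk8
  have hkp : (0 : ℝ) < (k : ℝ) + 1 := by positivity
  have hyk := hyc k (by omega)
  refine ⟨lt_of_lt_of_le (by positivity) hyk, ?_⟩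
  rw [div_le_iff₀ (by positivity)] at hk
  have hsplit : ((k : ℝ) + 1) ^ (2 / 5 : ℝ) =
      ((k : ℝ) + 1) ^ (1 / 15 : ℝ) * ((k : ℝ) + 1) ^ (1 / 3 : ℝ) := by
    rw [← Real.rpow_add hkp]; norm_num
  calc x k ≤ K * ((k : ℝ) + 1) ^ (1 / 3 : ℝ) := hxK k hk8
    _ ≤ ((k : ℝ) + 1) ^ (1 / 15 : ℝ) * (ε * c) * ((k : ℝ) + 1) ^ (1 / 3 : ℝ) :=
      mul_le_mul_of_nonneg_right hk (by positivity)
    _ = ε * (c * ((k : ℝ) + 1) ^ (2 / 5 : ℝ)) := by rw [hsplit]; ring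
    _ ≤ ε * y k := mul_le_mul_of_nonneg_left hyk hε.le

theorem regCount_succ {n : ℕ} (p : Matrix (Fin (n + 1)) (Fin (n + 1)) Bool → Prop)
    (hp : ∀ A (σ τ : Equiv.Perm (Fin (n + 1))), p A → p (A.submatrix σ τ)) :
    (regCount (n + 1) p : ℝ) =
      (n + 1) / 2 * regCount (n + 1) (fun A => p A ∧ A 0 0 = true) := by
  have h := card_corner p hp
  have h' : ((n : ℝ) + 1) * regCount (n + 1) (fun A => p A ∧ A 0 0 = true) =
      2 * regCount (n + 1) p := by exact_mod_cast h
  linarith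

/-- Counts of matrices in `M_{k+1,2}` with corner entry one, normalised by `k! ^ 2`. -/
def cornerRatio (k : ℕ) (p : Matrix (Fin (k + 1)) (Fin (k + 1)) Bool → Prop) : ℝ :=
  regCount (k + 1) (fun A => p A ∧ A 0 0 = true) / (k.factorial : ℝ) ^ 2

theorem cornerRatio_succ_succ (k : ℕ) :
    cornerRatio (k + 2) (fun _ => True) =
      cornerRatio (k + 1) (fun _ => True) +
        cornerRatio k (fun _ => True) / (2 * (k + 1)) := by
  have h : (k.factorial : ℝ) ≠ 0 := by positivity
  have hk : (k : ℝ) + 1 ≠ 0 := by positivity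
  have hk' : (k : ℝ) + 2 ≠ 0 := by positivity
  rw [cornerRatio, cornerRatio, cornerRatio, cornerCount_recursion, Nat.factorial_succ (k + 1),
    Nat.factorial_succ k]
  push_cast
  rw [regCount_succ (fun _ => True) (fun _ _ _ _ => trivial)]
  field_simp

theorem cornerRatio_nonsingular_recursion (k : ℕ) :
    cornerRatio (k + 3) (fun A => (b2r A).det ≠ 0) =
      cornerRatio (k + 1) (fun A => (b2r A).det ≠ 0) +
        cornerRatio k (fun A => (b2r A).det ≠ 0) / (2 * (k + 1)) := by
  have h : (k.factorial : ℝ) ≠ 0 := by positivity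
  have hk : (k : ℝ) + 1 ≠ 0 := by positivity
  have hk' : (k : ℝ) + 2 ≠ 0 := by positivity
  have hk'' : (k : ℝ) + 3 ≠ 0 := by positivity
  rw [cornerRatio, cornerRatio, cornerRatio, cornerCount_nonsingular_recursion,
    cornerCount_negCorner_recursion, Nat.factorial_succ (k + 2), Nat.factorial_succ (k + 1),
    Nat.factorial_succ k]
  push_cast
  rw [regCount_succ (fun A => (b2r A).det ≠ 0) det_b2r_submatrix]
  field_simp

theorem cornerRatio_one_pos : 0 < cornerRatio 1 (fun _ => True) := by
  have h0 : regCount 0 (fun _ => True) = 1 := by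
    simp only [regCount, regSet, IsEmpty.forall_iff, and_self, Finset.filter_true]
    exact Fintype.card_eq_one_iff.2 ⟨fun i => i.elim0, fun A => by ext i; exact i.elim0⟩
  rw [cornerRatio, cornerCount_recursion, h0]
  positivity

theorem two_regular_singular_aas :
    ∀ ε : ℝ, 0 < ε → ∃ N : ℕ, ∀ n, N ≤ n →
      1 - ε ≤ cprob (regSet n 2) (fun A => (b2r A).det = 0) := by
  intro ε hε
  obtain ⟨N, hN⟩ := Filter.eventually_atTop.1 <| eventually_le_mul_of_recursions
    (x := fun k => cornerRatio k fun A => (b2r A).det ≠ 0)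
    (y := fun k => cornerRatio k fun _ => True)
    (fun k => by unfold cornerRatio; positivity) (by unfold cornerRatio; positivity)
    cornerRatio_one_pos cornerRatio_nonsingular_recursion cornerRatio_succ_succ hε
  refine ⟨N + 1, fun n hn => ?_⟩
  obtain ⟨k, rfl⟩ : ∃ k, n = k + 1 := ⟨n - 1, by omega⟩
  obtain ⟨hpos, hle⟩ := hN k (by omega)
  have hf : (0 : ℝ) < (k.factorial : ℝ) ^ 2 := by positivity
  simp only [cornerRatio] at hpos hle
  rw [← mul_div_assoc, div_le_div_iff_of_pos_right hf] at hle
  rw [div_pos_iff_of_pos_right hf] at hpos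
  have hT := regCount_succ (n := k) (fun _ => True) (fun _ _ _ _ => trivial)
  have hO := regCount_succ (n := k) (fun A => (b2r A).det ≠ 0) det_b2r_submatrix
  have hk : (0 : ℝ) < ((k : ℝ) + 1) / 2 := by positivity
  have hle' : (regCount (k + 1) (fun A => (b2r A).det ≠ 0) : ℝ) ≤
      ε * regCount (k + 1) fun _ => True := by
    rw [hT, hO, mul_left_comm]
    exact mul_le_mul_of_nonneg_left hle hk.le
  have hpos' : (0 : ℝ) < regCount (k + 1) fun _ => True := by
    rw [hT]; exact mul_pos hk hpos
  have hcard : regCount (k + 1) (fun _ => True) = (regSet (k + 1) 2).card := by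
    simp [regCount]
  rw [hcard] at hle' hpos'
  have hsum := Finset.card_filter_add_card_filter_not (s := regSet (k + 1) 2)
    (fun A => (b2r A).det = 0)
  have hsum' : (((regSet (k + 1) 2).filter fun A => (b2r A).det = 0).card : ℝ) +
      regCount (k + 1) (fun A => (b2r A).det ≠ 0) = (regSet (k + 1) 2).card := by
    rw [← hsum, regCount]
    push_cast
    congr!
  rw [cprob, le_div_iff₀ hpos']
  have : (((regSet (k + 1) 2).filter fun A => (b2r A).det = 0).card : ℝ) ≥
    (1 - ε) * (regSet (k + 1) 2).card := by linarith
  convert this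

end
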